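/- Let G be a group, and let Q and Q' be G-groups admitting finite filtrations Q = Q_1 ≥ Q_2 ≥ ⋯ ≥ Q_{n+1} = {1} and Q' = Q'_1 ≥ Q'_2 ≥ ⋯ ≥ Q'_{n+1} = {1} of the same length, in which each Q_i (resp. Q'_i) is normal in Q (resp. Q') and G-stable, and Q_i/Q_{i+1} ≤ Z(Q/Q_{i+1}) and Q'_i/Q'_{i+1} ≤ Z(Q'/Q'_{i+1}) for each i. Let ρ : Q → Q' be a G-equivariant homomorphism with ρ(Q_i) ≤ Q'_i for each i. Suppose that for every 1 ≤ j ≤ n the maps induced by ρ satisfy: H^1(G,Q_j/Q_{j+1}) → H^1(G,Q'_j/Q'_{j+1}) is bijective; H^0(G,Q_j/Q_{j+1}) → H^0(G,Q'_j/Q'_{j+1}) is surjective; and H^2(G,Q_j/Q_{j+1}) → H^2(G,Q'_j/Q'_{j+1}) is injective. Then the map H^1(G,Q) → H^1(G,Q') induced by ρ is a bijection. -/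

import Mathlib

/-- A right action of a group `G` on a group `Q` by group automorphisms,
written `q ↦ q^g` in the paper; here `act q g`. -/
structure GAction (G : Type*) (Q : Type*) [Group G] [Group Q] where
  act : Q → G → Q
  act_one : ∀ q, act q 1 = q
  act_mul : ∀ q g h, act (act q g) h = act q (g * h)
  act_map_mul : ∀ g q q', act (q * q') g = act q g * act q' g

namespace GAction

variable {G Q : Type*} [Group G] [Group Q]

/-- `γ : G → Q` is a 1-cocycle: `γ(gh) = γ(g)^h · γ(h)`. -/
def IsCocycle (A : GAction G Q) (γ : G → Q) : Prop :=
  ∀ g h : G, γ (g * h) = A.act (γ g) h * γ h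

/-- Two 1-cochains are cohomologous: `δ(g) = (q^g)⁻¹ · γ(g) · q` for some `q`. -/
def Cohomologous (A : GAction G Q) (γ δ : G → Q) : Prop :=
  ∃ q : Q, ∀ g : G, δ g = (A.act q g)⁻¹ * γ g * q

/-- `τ : G × G → Q` is a 2-cocycle: `τ(g,h)^k · τ(gh,k) = τ(h,k) · τ(g,hk)`. -/
def IsTwoCocycle (A : GAction G Q) (τ : G → G → Q) : Prop :=
  ∀ g h k : G, A.act (τ g h) k * τ (g * h) k = τ h k * τ g (h * k)

/-- Two 2-cochains are cohomologous:
`τ'(g,h) = τ(g,h) · φ(g)^h · φ(h) · φ(gh)⁻¹` for some `φ : G → Q`. -/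
def TwoCohomologous (A : GAction G Q) (τ τ' : G → G → Q) : Prop :=
  ∃ φ : G → Q, ∀ g h : G, τ' g h = τ g h * A.act (φ g) h * φ h * (φ (g * h))⁻¹

/-- The restriction of a `G`-action to a subgroup `B ≤ G`. -/
def res (A : GAction G Q) (B : Subgroup G) : GAction B Q where
  act q b := A.act q (b : G)
  act_one q := by simpa using A.act_one q
  act_mul q b c := by simpa using A.act_mul q (b : G) (c : G)
  act_map_mul b q q' := A.act_map_mul (b : G) q q'

end GAction

/-- `1 → R →(ι) Q →(π) S → 1` is a central extension of `G`-groups. -/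
structure IsCentralExt {G R Q S : Type*} [Group G] [Group R] [Group Q] [Group S]
    (AR : GAction G R) (AQ : GAction G Q) (AS : GAction G S)
    (ι : R →* Q) (π : Q →* S) : Prop where
  ι_inj : Function.Injective ι
  π_surj : Function.Surjective π
  exact : ∀ q : Q, π q = 1 ↔ ∃ r : R, ι r = q
  ι_equiv : ∀ (r : R) (g : G), ι (AR.act r g) = AQ.act (ι r) g
  π_equiv : ∀ (q : Q) (g : G), π (AQ.act q g) = AS.act (π q) g
  central : ∀ (r : R) (q : Q), ι r * q = q * ι r

namespace GAction

section Twist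

variable {G Q Q' : Type*} [Group G] [Group Q] [Group Q']

/-- The automorphism of `Q` given by an element of `G`. -/
def actHom (A : GAction G Q) (g : G) : Q →* Q :=
  MonoidHom.mk' (fun q => A.act q g) (A.act_map_mul g)

theorem map_one (A : GAction G Q) (g : G) : A.act 1 g = 1 := (A.actHom g).map_one

theorem map_inv (A : GAction G Q) (q : Q) (g : G) : A.act q⁻¹ g = (A.act q g)⁻¹ :=
  (A.actHom g).map_inv q

/-- The action of `Q` on 1-cochains whose orbits are the cohomology classes. -/
def twist (A : GAction G Q) (q : Q) (γ : G → Q) (g : G) : Q := (A.act q g)⁻¹ * γ g * q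

theorem twist_twist (A : GAction G Q) (p q : Q) (γ : G → Q) :
    A.twist q (A.twist p γ) = A.twist (p * q) γ := by
  funext g
  simp only [twist, A.act_map_mul]
  group

theorem comp_twist {A : GAction G Q} {A' : GAction G Q'} {ρ : Q →* Q'}
    (hρ : ∀ (q : Q) (g : G), ρ (A.act q g) = A'.act (ρ q) g) (q : Q) (γ : G → Q) :
    ρ ∘ A.twist q γ = A'.twist (ρ q) (ρ ∘ γ) := by
  funext g
  simp [twist, hρ]

theorem twist_mul_right (A : GAction G Q) (q : Q) (γ z : G → Q)
    (hz : ∀ g, z g ∈ Subgroup.center Q) : A.twist q (γ * z) = A.twist q γ * z := by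
  funext g
  simp only [twist, Pi.mul_apply, mul_assoc, Subgroup.mem_center_iff.1 (hz g) q]

theorem twist_mul_left (A : GAction G Q) (q : Q) (γ z : G → Q)
    (hq : ∀ g, A.act q g ∈ Subgroup.center Q) : A.twist q (γ * z) = γ * A.twist q z := by
  funext g
  simp only [twist, Pi.mul_apply, ← mul_assoc,
    Subgroup.mem_center_iff.1 (Subgroup.inv_mem _ (hq g)) (γ g)]

theorem act_twist_mul_twist (A : GAction G Q) (q : Q) (γ : G → Q) (g h : G) :
    A.act (A.twist q γ g) h * A.twist q γ h =
      (A.act q (g * h))⁻¹ * (A.act (γ g) h * γ h) * q := by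
  simp only [twist, A.act_map_mul, A.map_inv, A.act_mul]
  group

theorem act_mul_mul_mul (A : GAction G Q) (γ z : G → Q) (g h : G)
    (hz : A.act (z g) h ∈ Subgroup.center Q) :
    A.act ((γ * z) g) h * (γ * z) h = A.act (γ g) h * γ h * (A.act (z g) h * z h) := by
  simp only [Pi.mul_apply, A.act_map_mul, mul_assoc]
  rw [← mul_assoc (γ h), Subgroup.mem_center_iff.1 hz (γ h), mul_assoc]

theorem IsCocycle.twist {A : GAction G Q} {γ : G → Q} (hγ : A.IsCocycle γ) (q : Q) :
    A.IsCocycle (A.twist q γ) := by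
  intro g h
  rw [act_twist_mul_twist, ← hγ g h]
  rfl

theorem IsCocycle.comp {A : GAction G Q} {A' : GAction G Q'} {ρ : Q →* Q'}
    (hρ : ∀ (q : Q) (g : G), ρ (A.act q g) = A'.act (ρ q) g) {γ : G → Q}
    (hγ : A.IsCocycle γ) : A'.IsCocycle (ρ ∘ γ) := by
  intro g h
  simp [hγ g h, hρ]

theorem IsCocycle.mul {A : GAction G Q} {γ z : G → Q} (hγ : A.IsCocycle γ)
    (hz : A.IsCocycle z) (hc : ∀ g h, A.act (z g) h ∈ Subgroup.center Q) :
    A.IsCocycle (γ * z) := by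
  intro g h
  rw [act_mul_mul_mul _ _ _ _ _ (hc g h), ← hγ g h, ← hz g h]
  rfl

theorem IsCocycle.inv {A : GAction G Q} {z : G → Q} (hz : A.IsCocycle z)
    (hc : ∀ g, z g ∈ Subgroup.center Q) : A.IsCocycle z⁻¹ := by
  intro g h
  simp only [Pi.inv_apply, hz g h, A.map_inv, mul_inv_rev]
  exact (Subgroup.mem_center_iff.1 (Subgroup.inv_mem _ (hc h)) _).symm

theorem IsCocycle.of_mul {A : GAction G Q} {γ z : G → Q} (hγ : A.IsCocycle γ)
    (hγz : A.IsCocycle (γ * z)) (hc : ∀ g h, A.act (z g) h ∈ Subgroup.center Q) :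
    A.IsCocycle z := by
  intro g h
  have e := hγz g h
  rw [act_mul_mul_mul _ _ _ _ _ (hc g h), ← hγ g h] at e
  exact mul_left_cancel e

end Twist

section Subquotient

variable {G Q Q' : Type*} [Group G] [Group Q] [Group Q']
  (A : GAction G Q) (A' : GAction G Q') (ρ : Q →* Q')
  (J K : Subgroup Q) (J' K' : Subgroup Q')

/-- Surjectivity of `H¹(G, J/K) → H¹(G, J'/K')`, on representatives. -/
def H1Surjective : Prop :=
  ∀ β : G → Q', (∀ g : G, β g ∈ J') →
    (∀ g h : G, (β (g * h))⁻¹ * (A'.act (β g) h * β h) ∈ K') →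
    ∃ γ : G → Q, (∀ g : G, γ g ∈ J) ∧
      (∀ g h : G, (γ (g * h))⁻¹ * (A.act (γ g) h * γ h) ∈ K) ∧
      ∃ q ∈ J', ∀ g : G, (β g)⁻¹ * ((A'.act q g)⁻¹ * ρ (γ g) * q) ∈ K'

/-- Injectivity of `H¹(G, J/K) → H¹(G, J'/K')`, on representatives. -/
def H1Injective : Prop :=
  ∀ γ δ : G → Q, (∀ g : G, γ g ∈ J) → (∀ g : G, δ g ∈ J) →
    (∀ g h : G, (γ (g * h))⁻¹ * (A.act (γ g) h * γ h) ∈ K) →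
    (∀ g h : G, (δ (g * h))⁻¹ * (A.act (δ g) h * δ h) ∈ K) →
    (∃ q ∈ J', ∀ g : G, (ρ (δ g))⁻¹ * ((A'.act q g)⁻¹ * ρ (γ g) * q) ∈ K') →
    ∃ q ∈ J, ∀ g : G, (δ g)⁻¹ * ((A.act q g)⁻¹ * γ g * q) ∈ K

/-- Surjectivity of `H⁰(G, J/K) → H⁰(G, J'/K')`, on representatives. -/
def H0Surjective : Prop :=
  ∀ q' ∈ J', (∀ g : G, (A'.act q' g)⁻¹ * q' ∈ K') →
    ∃ q ∈ J, (∀ g : G, (A.act q g)⁻¹ * q ∈ K) ∧ (ρ q)⁻¹ * q' ∈ K'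

/-- Injectivity of `H²(G, J/K) → H²(G, J'/K')`, on representatives. -/
def H2Injective : Prop :=
  ∀ τ τ' : G → G → Q, (∀ g h : G, τ g h ∈ J) → (∀ g h : G, τ' g h ∈ J) →
    (∀ g h k : G, (A.act (τ g h) k * τ (g * h) k)⁻¹ * (τ h k * τ g (h * k)) ∈ K) →
    (∀ g h k : G, (A.act (τ' g h) k * τ' (g * h) k)⁻¹ * (τ' h k * τ' g (h * k)) ∈ K) →
    (∃ φ : G → Q', (∀ g : G, φ g ∈ J') ∧ ∀ g h : G,
      (ρ (τ' g h))⁻¹ * (ρ (τ g h) * A'.act (φ g) h * φ h * (φ (g * h))⁻¹) ∈ K') →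
    ∃ φ : G → Q, (∀ g : G, φ g ∈ J) ∧ ∀ g h : G,
      (τ' g h)⁻¹ * (τ g h * A.act (φ g) h * φ h * (φ (g * h))⁻¹) ∈ K

/-- Surjectivity of `H⁰(G, Q/K) → H⁰(G, Q'/K')` for the action twisted by any 1-cocycle
with values in `Q/K`, on representatives. -/
def TwistedH0Surjective : Prop :=
  ∀ γ : G → Q, (∀ g h : G, (γ (g * h))⁻¹ * (A.act (γ g) h * γ h) ∈ K) →
    ∀ q' : Q', (∀ g : G, (ρ (γ g))⁻¹ * ((A'.act q' g)⁻¹ * ρ (γ g) * q') ∈ K') →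
    ∃ q : Q, (∀ g : G, (γ g)⁻¹ * ((A.act q g)⁻¹ * γ g * q) ∈ K) ∧ (ρ q)⁻¹ * q' ∈ K'

end Subquotient

section Comap

variable {G Q Q' P P' : Type*} [Group G] [Group Q] [Group Q'] [Group P] [Group P']
  {A : GAction G Q} {A' : GAction G Q'} {ρ : Q →* Q'}
  {B : GAction G P} {B' : GAction G P'} {σ : P →* P'} {π : Q →* P} {π' : Q' →* P'}
  {J K : Subgroup P} {J' K' : Subgroup P'}

theorem h1Surjective_comap (hπ : Function.Surjective π) (hπ' : Function.Surjective π')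
    (hA : ∀ (q : Q) (g : G), π (A.act q g) = B.act (π q) g)
    (hA' : ∀ (q : Q') (g : G), π' (A'.act q g) = B'.act (π' q) g)
    (hσ : ∀ q, π' (ρ q) = σ (π q)) :
    H1Surjective A A' ρ (J.comap π) (K.comap π) (J'.comap π') (K'.comap π') ↔
      H1Surjective B B' σ J K J' K' := by
  simp only [H1Surjective, Subgroup.mem_comap, map_mul, _root_.map_inv, hA, hA', hσ]
  rw [hπ'.comp_left.forall]
  refine forall_congr' fun β => imp_congr_right fun _ => imp_congr_right fun _ => ?_
  rw [hπ.comp_left.exists]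
  refine exists_congr fun γ => and_congr_right fun _ => and_congr_right fun _ => ?_
  rw [hπ'.exists]
  rfl

theorem h1Injective_comap (hπ : Function.Surjective π) (hπ' : Function.Surjective π')
    (hA : ∀ (q : Q) (g : G), π (A.act q g) = B.act (π q) g)
    (hA' : ∀ (q : Q') (g : G), π' (A'.act q g) = B'.act (π' q) g)
    (hσ : ∀ q, π' (ρ q) = σ (π q)) :
    H1Injective A A' ρ (J.comap π) (K.comap π) (J'.comap π') (K'.comap π') ↔
      H1Injective B B' σ J K J' K' := by
  simp only [H1Injective, Subgroup.mem_comap, map_mul, _root_.map_inv, hA, hA', hσ]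
  rw [hπ.comp_left.forall]
  refine forall_congr' fun γ => ?_
  rw [hπ.comp_left.forall]
  refine forall_congr' fun δ => imp_congr_right fun _ => imp_congr_right fun _ =>
    imp_congr_right fun _ => imp_congr_right fun _ => ?_
  rw [hπ.exists, hπ'.exists]
  rfl

theorem h0Surjective_comap (hπ : Function.Surjective π) (hπ' : Function.Surjective π')
    (hA : ∀ (q : Q) (g : G), π (A.act q g) = B.act (π q) g)
    (hA' : ∀ (q : Q') (g : G), π' (A'.act q g) = B'.act (π' q) g)
    (hσ : ∀ q, π' (ρ q) = σ (π q)) :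
    H0Surjective A A' ρ (J.comap π) (K.comap π) (J'.comap π') (K'.comap π') ↔
      H0Surjective B B' σ J K J' K' := by
  simp only [H0Surjective, Subgroup.mem_comap, map_mul, _root_.map_inv, hA, hA', hσ]
  rw [hπ'.forall]
  refine forall_congr' fun q' => imp_congr_right fun _ => imp_congr_right fun _ => ?_
  rw [hπ.exists]

theorem h2Injective_comap (hπ : Function.Surjective π) (hπ' : Function.Surjective π')
    (hA : ∀ (q : Q) (g : G), π (A.act q g) = B.act (π q) g)
    (hA' : ∀ (q : Q') (g : G), π' (A'.act q g) = B'.act (π' q) g)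
    (hσ : ∀ q, π' (ρ q) = σ (π q)) :
    H2Injective A A' ρ (J.comap π) (K.comap π) (J'.comap π') (K'.comap π') ↔
      H2Injective B B' σ J K J' K' := by
  simp only [H2Injective, Subgroup.mem_comap, map_mul, _root_.map_inv, hA, hA', hσ]
  rw [hπ.comp_left.comp_left.forall]
  refine forall_congr' fun τ => ?_
  rw [hπ.comp_left.comp_left.forall]
  refine forall_congr' fun τ' => imp_congr_right fun _ => imp_congr_right fun _ =>
    imp_congr_right fun _ => imp_congr_right fun _ => ?_
  rw [hπ.comp_left.exists, hπ'.comp_left.exists]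
  rfl

theorem twistedH0Surjective_comap (hπ : Function.Surjective π) (hπ' : Function.Surjective π')
    (hA : ∀ (q : Q) (g : G), π (A.act q g) = B.act (π q) g)
    (hA' : ∀ (q : Q') (g : G), π' (A'.act q g) = B'.act (π' q) g)
    (hσ : ∀ q, π' (ρ q) = σ (π q)) :
    TwistedH0Surjective A A' ρ (K.comap π) (K'.comap π') ↔
      TwistedH0Surjective B B' σ K K' := by
  simp only [TwistedH0Surjective, Subgroup.mem_comap, map_mul, _root_.map_inv, hA, hA', hσ]
  rw [hπ.comp_left.forall]
  refine forall_congr' fun γ => imp_congr_right fun _ => ?_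
  rw [hπ'.forall]
  refine forall_congr' fun q' => imp_congr_right fun _ => ?_
  rw [hπ.exists]
  rfl

end Comap

section CentralStep

variable {G Q Q' : Type*} [Group G] [Group Q] [Group Q']
  {A : GAction G Q} {A' : GAction G Q'} {ρ : Q →* Q'} {R : Subgroup Q} {R' : Subgroup Q'}

theorem exists_twist_eq_one (hi : H1Injective A A' ρ R ⊥ R' ⊥) {z : G → Q}
    (hz : A.IsCocycle z) (hzR : ∀ g, z g ∈ R) {t : Q'} (ht : t ∈ R')
    (h : A'.twist t (ρ ∘ z) = 1) : ∃ u ∈ R, A.twist u z = 1 := by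
  obtain ⟨u, hu, e⟩ := hi z 1 hzR (fun _ => R.one_mem)
    (fun g h => by simp [hz g h]) (fun g h => by simp [A.map_one])
    ⟨t, ht, fun g => by simpa [twist] using congrFun h g⟩
  exact ⟨u, hu, funext fun g => by simpa [twist] using e g⟩

theorem twistedH0Surjective_of_central (hR : R ≤ Subgroup.center Q)
    (hR' : R' ≤ Subgroup.center Q')
    (hst : ∀ q ∈ R, ∀ g, A.act q g ∈ R) (hst' : ∀ q ∈ R', ∀ g, A'.act q g ∈ R')
    (hρ : ∀ (q : Q) (g : G), ρ (A.act q g) = A'.act (ρ q) g) (hρR : ∀ q ∈ R, ρ q ∈ R')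
    (hi : H1Injective A A' ρ R ⊥ R' ⊥) (h0 : H0Surjective A A' ρ R ⊥ R' ⊥)
    (ht0 : TwistedH0Surjective A A' ρ R R') : TwistedH0Surjective A A' ρ ⊥ ⊥ := by
  intro γ hγ q' hq'
  simp only [Subgroup.mem_bot, inv_mul_eq_one] at hγ hq' ⊢
  obtain ⟨q, hq, ht⟩ := ht0 γ (fun g h => by simp [hγ g h, R.one_mem]) q'
    (fun g => by rw [← hq' g]; simp [R'.one_mem])
  set t := (ρ q)⁻¹ * q' with ht_def
  obtain ⟨r, hr⟩ : ∃ r : G → Q, r = γ⁻¹ * A.twist q γ := ⟨_, rfl⟩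
  have hrR : ∀ g, r g ∈ R := fun g => by rw [hr]; exact hq g
  have hγr : A.twist q γ = γ * r := by rw [hr, mul_inv_cancel_left]
  have hγc : A.IsCocycle γ := hγ
  have hrc : A.IsCocycle r := hγc.of_mul (hγr ▸ hγc.twist q) fun g h => hR (hst _ (hrR g) h)
  have htr : A'.twist t (ρ ∘ r) = 1 := by
    have e : A'.twist q' (ρ ∘ γ) = ρ ∘ γ := funext fun g => (hq' g).symm
    have e1 : q' = ρ q * t := by simp [ht_def]
    have e2 : ρ ∘ (γ * r) = (ρ ∘ γ) * (ρ ∘ r) := by ext; simp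
    rw [e1, ← twist_twist, ← comp_twist hρ, hγr, e2,
      twist_mul_left _ _ _ _ fun g => hR' (hst' _ ht g)] at e
    simpa using e
  obtain ⟨u, hu, hur⟩ := exists_twist_eq_one hi hrc hrR ht htr
  obtain ⟨v, hv, hvf, hvt⟩ := h0 ((ρ u)⁻¹ * t) (R'.mul_mem (R'.inv_mem (hρR u hu)) ht) (by
    intro g
    have e : A'.twist ((ρ u)⁻¹ * t) (ρ ∘ A.twist u r) = 1 := by
      rw [comp_twist hρ, twist_twist, mul_inv_cancel_left, htr]
    simpa [hur, twist] using congrFun e g)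
  simp only [Subgroup.mem_bot, inv_mul_eq_one] at hvf hvt
  refine ⟨q * u * v, fun g => ?_, by rw [_root_.map_mul, _root_.map_mul, hvt, ht_def]; group⟩
  have e : A.twist (q * u * v) γ = γ := by
    rw [← twist_twist, ← twist_twist, hγr, twist_mul_left _ _ _ _ fun g => hR (hst _ hu g), hur,
      twist_mul_left _ _ _ _ fun g => hR (hst _ hv g)]
    funext g
    simp [twist, hvf g]
  exact (congrFun e g).symm

theorem h1Injective_of_central (hR : R ≤ Subgroup.center Q)
    (hR' : R' ≤ Subgroup.center Q')
    (hst : ∀ q ∈ R, ∀ g, A.act q g ∈ R) (hst' : ∀ q ∈ R', ∀ g, A'.act q g ∈ R')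
    (hρ : ∀ (q : Q) (g : G), ρ (A.act q g) = A'.act (ρ q) g) (hρR : ∀ q ∈ R, ρ q ∈ R')
    (hi : H1Injective A A' ρ R ⊥ R' ⊥) (ht0 : TwistedH0Surjective A A' ρ R R')
    (hI : H1Injective A A' ρ ⊤ R ⊤ R') : H1Injective A A' ρ ⊤ ⊥ ⊤ ⊥ := by
  rintro γ δ - - hγ hδ ⟨q', -, hq'⟩
  simp only [Subgroup.mem_bot, inv_mul_eq_one] at hγ hδ hq' ⊢
  obtain ⟨q, -, hq⟩ := hI γ δ (fun _ => Subgroup.mem_top _) (fun _ => Subgroup.mem_top _)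
    (fun g h => by simp [hγ g h, R.one_mem]) (fun g h => by simp [hδ g h, R.one_mem])
    ⟨q', Subgroup.mem_top _, fun g => by rw [← hq' g]; simp [R'.one_mem]⟩
  obtain ⟨r, hr⟩ : ∃ r : G → Q, r = δ⁻¹ * A.twist q γ := ⟨_, rfl⟩
  have hrR : ∀ g, r g ∈ R := fun g => by rw [hr]; exact hq g
  have hδr : A.twist q γ = δ * r := by rw [hr, mul_inv_cancel_left]
  have hδρ : ρ ∘ (δ * r) = (ρ ∘ δ) * (ρ ∘ r) := by ext; simp
  have hx : A'.twist ((ρ q)⁻¹ * q') (ρ ∘ δ) * (ρ ∘ r) = ρ ∘ δ := by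
    rw [← twist_mul_right _ _ _ (ρ ∘ r) fun g => hR' (hρR _ (hrR g)), ← hδρ, ← hδr, comp_twist hρ,
      twist_twist, mul_inv_cancel_left]
    exact funext fun g => (hq' g).symm
  obtain ⟨p, hp, ht⟩ := ht0 δ (fun g h => by simp [hδ g h, R.one_mem]) ((ρ q)⁻¹ * q') (by
    intro g
    have e : A'.twist ((ρ q)⁻¹ * q') (ρ ∘ δ) g = ρ (δ g) * (ρ (r g))⁻¹ :=
      eq_mul_inv_of_mul_eq (congrFun hx g)
    have e' : (ρ (δ g))⁻¹ * A'.twist ((ρ q)⁻¹ * q') (ρ ∘ δ) g ∈ R' := by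
      rw [e, inv_mul_cancel_left]
      exact R'.inv_mem (hρR _ (hrR g))
    exact e')
  set t := (ρ p)⁻¹ * ((ρ q)⁻¹ * q') with ht_def
  obtain ⟨w, hw⟩ : ∃ w : G → Q, w = δ⁻¹ * A.twist p δ := ⟨_, rfl⟩
  have hwR : ∀ g, w g ∈ R := fun g => by rw [hw]; exact hp g
  have hδw : A.twist p δ = δ * w := by rw [hw, mul_inv_cancel_left]
  have hwrR : ∀ g, (w * r) g ∈ R := fun g => R.mul_mem (hwR g) (hrR g)
  have hz : A.twist (q * p) γ = δ * (w * r) := by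
    rw [← twist_twist, hδr, twist_mul_right _ _ _ _ fun g => hR (hrR g), hδw, mul_assoc]
  have hγc : A.IsCocycle γ := fun g h => hγ g h
  have hδc : A.IsCocycle δ := fun g h => hδ g h
  have hzc : A.IsCocycle (w * r) :=
    hδc.of_mul (hz ▸ hγc.twist (q * p)) fun g h => hR (hst _ (hwrR g) h)
  have htz : A'.twist t (ρ ∘ (w * r)) = 1 := by
    have e : A'.twist q' (ρ ∘ γ) = ρ ∘ δ := funext fun g => (hq' g).symm
    have e1 : q' = ρ (q * p) * t := by simp [ht_def, mul_assoc]
    have e2 : ρ ∘ (δ * (w * r)) = (ρ ∘ δ) * (ρ ∘ (w * r)) := by ext; simp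
    rw [e1, ← twist_twist, ← comp_twist hρ, hz, e2,
      twist_mul_left _ _ _ _ fun g => hR' (hst' _ ht g)] at e
    simpa using e
  obtain ⟨u, hu, huz⟩ := exists_twist_eq_one hi hzc hwrR ht htz
  refine ⟨q * p * u, Subgroup.mem_top _, fun g => ?_⟩
  have e : A.twist (q * p * u) γ = δ := by
    rw [← twist_twist, hz, twist_mul_left _ _ _ _ fun g => hR (hst _ hu g), huz, mul_one]
  exact (congrFun e g).symm

/-- The failure of a 1-cochain to be a cocycle, when central, is a 2-cocycle. -/
theorem isTwoCocycle_of_central (A : GAction G Q) {γ : G → Q} {τ : G → G → Q}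
    (hγ : ∀ g h, A.act (γ g) h * γ h = γ (g * h) * τ g h)
    (hτ : ∀ g h k, A.act (τ g h) k ∈ Subgroup.center Q) : A.IsTwoCocycle τ := by
  intro g h k
  have e1 : A.act (A.act (γ g) h * γ h) k * γ k =
      γ (g * h * k) * (τ (g * h) k * A.act (τ g h) k) := by
    rw [hγ, A.act_map_mul, mul_assoc, ← Subgroup.mem_center_iff.1 (hτ g h k), ← mul_assoc, hγ,
      mul_assoc]
  have e2 : A.act (A.act (γ g) h * γ h) k * γ k =
      γ (g * h * k) * (τ g (h * k) * τ h k) := by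
    rw [A.act_map_mul, A.act_mul, mul_assoc, hγ h k, ← mul_assoc, hγ g (h * k), mul_assoc,
      mul_assoc]
  have hτ' : τ h k ∈ Subgroup.center Q := by simpa [A.act_one] using hτ h k 1
  rw [← Subgroup.mem_center_iff.1 (hτ g h k), ← Subgroup.mem_center_iff.1 hτ']
  exact mul_left_cancel (e1.symm.trans e2)

theorem h1Surjective_of_central (hR : R ≤ Subgroup.center Q)
    (hR' : R' ≤ Subgroup.center Q')
    (hst : ∀ q ∈ R, ∀ g, A.act q g ∈ R) (hst' : ∀ q ∈ R', ∀ g, A'.act q g ∈ R')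
    (hρ : ∀ (q : Q) (g : G), ρ (A.act q g) = A'.act (ρ q) g) (hρR : ∀ q ∈ R, ρ q ∈ R')
    (hs : H1Surjective A A' ρ R ⊥ R' ⊥) (h2 : H2Injective A A' ρ R ⊥ R' ⊥)
    (hS : H1Surjective A A' ρ ⊤ R ⊤ R') : H1Surjective A A' ρ ⊤ ⊥ ⊤ ⊥ := by
  rintro β - hβ
  simp only [Subgroup.mem_bot, inv_mul_eq_one] at hβ ⊢
  obtain ⟨γ, -, hγ, s, -, hb⟩ := hS β (fun _ => Subgroup.mem_top _)
    (fun g h => by simp [hβ g h, R'.one_mem])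
  obtain ⟨τ, hτ⟩ : ∃ τ : G → G → Q, ∀ g h, τ g h = (γ (g * h))⁻¹ * (A.act (γ g) h * γ h) :=
    ⟨_, fun _ _ => rfl⟩
  have hτR : ∀ g h, τ g h ∈ R := fun g h => hτ g h ▸ hγ g h
  have hγτ : ∀ g h, A.act (γ g) h * γ h = γ (g * h) * τ g h := fun g h => by
    rw [hτ, mul_inv_cancel_left]
  obtain ⟨b, hb_def⟩ : ∃ b : G → Q', b = β⁻¹ * A'.twist s (ρ ∘ γ) := ⟨_, rfl⟩
  have hbR : ∀ g, b g ∈ R' := fun g => by rw [hb_def]; exact hb g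
  have hβb : A'.twist s (ρ ∘ γ) = β * b := by rw [hb_def, mul_inv_cancel_left]
  have hτc := A.isTwoCocycle_of_central hγτ fun g h k => hR (hst _ (hτR g h) k)
  have hτb : ∀ g h, ρ (τ g h) = A'.act (b g) h * b h * (b (g * h))⁻¹ := by
    intro g h
    have c1 := Subgroup.mem_center_iff.1 (hR' (hρR _ (hτR g h)))
    have e : A'.act (ρ (γ g)) h * ρ (γ h) = ρ (γ (g * h)) * ρ (τ g h) := by
      rw [← hρ, ← map_mul, hγτ, map_mul]
    have e1 := A'.act_twist_mul_twist s (ρ ∘ γ) g h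
    simp only [Function.comp_apply] at e1
    rw [e, mul_assoc, mul_assoc, ← c1 s, ← mul_assoc, ← mul_assoc] at e1
    change _ = A'.twist s (ρ ∘ γ) (g * h) * ρ (τ g h) at e1
    rw [hβb, act_mul_mul_mul _ _ _ _ _ (hR' (hst' _ (hbR g) h)), ← hβ g h, Pi.mul_apply,
      mul_assoc] at e1
    rw [eq_mul_inv_iff_mul_eq, ← c1, mul_left_cancel e1]
  obtain ⟨φ, hφR, hφ⟩ := h2 1 τ (fun _ _ => R.one_mem) hτR (by simp [A.map_one])
    (fun g h k => by rw [hτc g h k, inv_mul_cancel]; exact Subgroup.one_mem _)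
    ⟨b, hbR, fun g h => by simp [← hτb g h]⟩
  simp only [Subgroup.mem_bot, inv_mul_eq_one, Pi.one_apply, one_mul] at hφ
  have hγφ : A.IsCocycle (γ * φ⁻¹) := by
    intro g h
    have c := Subgroup.mem_center_iff.1 (Subgroup.inv_mem _ (hR (hφR (g * h))))
    have hi : A.act (φ⁻¹ g) h ∈ Subgroup.center Q := hR (hst _ (R.inv_mem (hφR g)) h)
    rw [act_mul_mul_mul _ _ _ _ _ hi, hγτ, hφ, c, ← Subgroup.mem_center_iff.1 hi]
    simp only [Pi.mul_apply, Pi.inv_apply, A.map_inv]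
    group
  have hρφR : ∀ g, (ρ ∘ φ⁻¹) g ∈ R' := fun g => hρR _ (R.inv_mem (hφR g))
  have hb1R : ∀ g, (b * (ρ ∘ φ⁻¹)) g ∈ R' := fun g => R'.mul_mem (hbR g) (hρφR g)
  have hβb1 : A'.twist s (ρ ∘ (γ * φ⁻¹)) = β * (b * (ρ ∘ φ⁻¹)) := by
    have e : ρ ∘ (γ * φ⁻¹) = (ρ ∘ γ) * (ρ ∘ φ⁻¹) := by ext; simp
    rw [e, twist_mul_right _ _ _ _ fun g => hR' (hρφR g), hβb, mul_assoc]
  have hβc : A'.IsCocycle β := fun g h => hβ g h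
  have hb1c : A'.IsCocycle (b * (ρ ∘ φ⁻¹)) :=
    hβc.of_mul (hβb1 ▸ (hγφ.comp hρ).twist s) fun g h => hR' (hst' _ (hb1R g) h)
  obtain ⟨c, hcR, hc, u, hu, hcu⟩ := hs _ hb1R
    (fun g h => by rw [hb1c g h, inv_mul_cancel]; exact Subgroup.one_mem _)
  simp only [Subgroup.mem_bot, inv_mul_eq_one] at hc hcu
  have hcc : A.IsCocycle c := hc
  have hciR : ∀ g, c⁻¹ g ∈ R := fun g => R.inv_mem (hcR g)
  have hγ1 : A.IsCocycle (γ * φ⁻¹ * c⁻¹) :=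
    hγφ.mul (hcc.inv fun g => hR (hcR g)) fun g h => hR (hst _ (hciR g) h)
  refine ⟨γ * φ⁻¹ * c⁻¹, fun _ => Subgroup.mem_top _, fun g h => hγ1 g h, s * u⁻¹,
    Subgroup.mem_top _, fun g => ?_⟩
  have hciR' : ∀ g, (ρ ∘ c⁻¹) g ∈ R' := fun g => hρR _ (hciR g)
  have huR' : ∀ g, A'.act u⁻¹ g ∈ R' := fun g => hst' _ (R'.inv_mem hu) g
  have hcu' : b * (ρ ∘ φ⁻¹) = A'.twist u (ρ ∘ c) := funext hcu
  have e : A'.twist (s * u⁻¹) (ρ ∘ (γ * φ⁻¹ * c⁻¹)) = β := by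
    have e1 : ρ ∘ (γ * φ⁻¹ * c⁻¹) = (ρ ∘ (γ * φ⁻¹)) * (ρ ∘ c⁻¹) := by ext; simp
    have e2 : (ρ ∘ c) * (ρ ∘ c⁻¹) = 1 := by ext; simp
    rw [e1, twist_mul_right _ _ _ _ fun g => hR' (hciR' g), ← twist_twist, hβb1, hcu',
      twist_mul_left _ _ _ _ fun g => hR' (huR' g), twist_twist, mul_inv_cancel, mul_assoc,
      ← twist_mul_right _ _ _ _ fun g => hR' (hciR' g), e2]
    funext g
    simp [twist, A'.map_one]
  exact (congrFun e g).symm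

end CentralStep

section Quotient

variable {G Q : Type*} [Group G] [Group Q]

/-- The action induced on the quotient by a stable normal subgroup. -/
def quotient (A : GAction G Q) (N : Subgroup Q) [N.Normal]
    (hN : ∀ q ∈ N, ∀ g, A.act q g ∈ N) : GAction G (Q ⧸ N) where
  act q g := QuotientGroup.map N N (A.actHom g) (fun q hq => hN q hq g) q
  act_one q := by
    obtain ⟨q, rfl⟩ := QuotientGroup.mk_surjective q
    exact congrArg _ (A.act_one q)
  act_mul q g h := by
    obtain ⟨q, rfl⟩ := QuotientGroup.mk_surjective q
    exact congrArg _ (A.act_mul q g h)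
  act_map_mul g q q' := _root_.map_mul _ q q'

end Quotient

section Step

variable {G Q Q' : Type*} [Group G] [Group Q] [Group Q']
  {A : GAction G Q} {A' : GAction G Q'} {ρ : Q →* Q'}
  {J K : Subgroup Q} {J' K' : Subgroup Q'}

theorem map_mk_le_center [K.Normal] (hc : ∀ q ∈ J, ∀ p : Q, q * p * q⁻¹ * p⁻¹ ∈ K) :
    J.map (QuotientGroup.mk' K) ≤ Subgroup.center (Q ⧸ K) := by
  rintro _ ⟨q, hq, rfl⟩
  rw [Subgroup.mem_center_iff]
  intro p
  obtain ⟨p, rfl⟩ := QuotientGroup.mk'_surjective K p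
  have e := (QuotientGroup.eq_one_iff _).2 (hc q hq p)
  rw [← commutatorElement_def] at e
  exact (commutatorElement_eq_one_iff_mul_comm.1
    ((map_commutatorElement (QuotientGroup.mk' K) q p).symm.trans e)).symm

theorem central_step [K.Normal] [K'.Normal] (hKJ : K ≤ J) (hKJ' : K' ≤ J')
    (hJ : ∀ q ∈ J, ∀ g, A.act q g ∈ J) (hK : ∀ q ∈ K, ∀ g, A.act q g ∈ K)
    (hJ' : ∀ q ∈ J', ∀ g, A'.act q g ∈ J') (hK' : ∀ q ∈ K', ∀ g, A'.act q g ∈ K')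
    (hc : ∀ q ∈ J, ∀ p : Q, q * p * q⁻¹ * p⁻¹ ∈ K)
    (hc' : ∀ q ∈ J', ∀ p : Q', q * p * q⁻¹ * p⁻¹ ∈ K')
    (hρ : ∀ (q : Q) (g : G), ρ (A.act q g) = A'.act (ρ q) g)
    (hρJ : ∀ q ∈ J, ρ q ∈ J') (hρK : ∀ q ∈ K, ρ q ∈ K')
    (hs : H1Surjective A A' ρ J K J' K') (hi : H1Injective A A' ρ J K J' K')
    (h0 : H0Surjective A A' ρ J K J' K') (h2 : H2Injective A A' ρ J K J' K')
    (hS : H1Surjective A A' ρ ⊤ J ⊤ J') (hI : H1Injective A A' ρ ⊤ J ⊤ J')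
    (hT : TwistedH0Surjective A A' ρ J J') :
    H1Surjective A A' ρ ⊤ K ⊤ K' ∧ H1Injective A A' ρ ⊤ K ⊤ K' ∧
      TwistedH0Surjective A A' ρ K K' := by
  have hπ := QuotientGroup.mk'_surjective K
  have hπ' := QuotientGroup.mk'_surjective K'
  have hA : ∀ (q : Q) (g : G), QuotientGroup.mk' K (A.act q g) =
      (A.quotient K hK).act (QuotientGroup.mk' K q) g := fun _ _ => rfl
  have hA' : ∀ (q : Q') (g : G), QuotientGroup.mk' K' (A'.act q g) =
      (A'.quotient K' hK').act (QuotientGroup.mk' K' q) g := fun _ _ => rfl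
  have hσ : ∀ q, QuotientGroup.mk' K' (ρ q) =
      QuotientGroup.map K K' ρ hρK (QuotientGroup.mk' K q) := fun _ => rfl
  have eJ : (J.map (QuotientGroup.mk' K)).comap (QuotientGroup.mk' K) = J :=
    Subgroup.comap_map_eq_self (by simpa using hKJ)
  have eJ' : (J'.map (QuotientGroup.mk' K')).comap (QuotientGroup.mk' K') = J' :=
    Subgroup.comap_map_eq_self (by simpa using hKJ')
  have eK : (⊥ : Subgroup (Q ⧸ K)).comap (QuotientGroup.mk' K) = K := by
    rw [MonoidHom.comap_bot, QuotientGroup.ker_mk']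
  have eK' : (⊥ : Subgroup (Q' ⧸ K')).comap (QuotientGroup.mk' K') = K' := by
    rw [MonoidHom.comap_bot, QuotientGroup.ker_mk']
  have eT := Subgroup.comap_top (QuotientGroup.mk' K)
  have eT' := Subgroup.comap_top (QuotientGroup.mk' K')
  replace hs := (h1Surjective_comap (K := ⊥) (K' := ⊥)
    (J := J.map (QuotientGroup.mk' K)) (J' := J'.map (QuotientGroup.mk' K')) hπ hπ' hA hA' hσ).1
    (by rwa [eJ, eJ', eK, eK'])
  replace hi := (h1Injective_comap (K := ⊥) (K' := ⊥)
    (J := J.map (QuotientGroup.mk' K)) (J' := J'.map (QuotientGroup.mk' K')) hπ hπ' hA hA' hσ).1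
    (by rwa [eJ, eJ', eK, eK'])
  replace h0 := (h0Surjective_comap (K := ⊥) (K' := ⊥)
    (J := J.map (QuotientGroup.mk' K)) (J' := J'.map (QuotientGroup.mk' K')) hπ hπ' hA hA' hσ).1
    (by rwa [eJ, eJ', eK, eK'])
  replace h2 := (h2Injective_comap (K := ⊥) (K' := ⊥)
    (J := J.map (QuotientGroup.mk' K)) (J' := J'.map (QuotientGroup.mk' K')) hπ hπ' hA hA' hσ).1
    (by rwa [eJ, eJ', eK, eK'])
  replace hS := (h1Surjective_comap (J := ⊤) (J' := ⊤)
    (K := J.map (QuotientGroup.mk' K)) (K' := J'.map (QuotientGroup.mk' K')) hπ hπ' hA hA' hσ).1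
    (by rwa [eT, eT', eJ, eJ'])
  replace hI := (h1Injective_comap (J := ⊤) (J' := ⊤)
    (K := J.map (QuotientGroup.mk' K)) (K' := J'.map (QuotientGroup.mk' K')) hπ hπ' hA hA' hσ).1
    (by rwa [eT, eT', eJ, eJ'])
  replace hT := (twistedH0Surjective_comap
    (K := J.map (QuotientGroup.mk' K)) (K' := J'.map (QuotientGroup.mk' K')) hπ hπ' hA hA' hσ).1
    (by rwa [eJ, eJ'])
  have hR := map_mk_le_center hc
  have hR' := map_mk_le_center hc'
  have hst : ∀ q ∈ J.map (QuotientGroup.mk' K), ∀ g,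
      (A.quotient K hK).act q g ∈ J.map (QuotientGroup.mk' K) := by
    rintro _ ⟨q, hq, rfl⟩ g
    exact ⟨_, hJ q hq g, rfl⟩
  have hst' : ∀ q ∈ J'.map (QuotientGroup.mk' K'), ∀ g,
      (A'.quotient K' hK').act q g ∈ J'.map (QuotientGroup.mk' K') := by
    rintro _ ⟨q, hq, rfl⟩ g
    exact ⟨_, hJ' q hq g, rfl⟩
  have hσR : ∀ q ∈ J.map (QuotientGroup.mk' K),
      QuotientGroup.map K K' ρ hρK q ∈ J'.map (QuotientGroup.mk' K') := by
    rintro _ ⟨q, hq, rfl⟩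
    exact ⟨_, hρJ q hq, rfl⟩
  have hσe : ∀ (q : Q ⧸ K) (g : G), QuotientGroup.map K K' ρ hρK ((A.quotient K hK).act q g) =
      (A'.quotient K' hK').act (QuotientGroup.map K K' ρ hρK q) g := by
    intro q g
    obtain ⟨q, rfl⟩ := hπ q
    exact congrArg (QuotientGroup.mk' K') (hρ q g)
  refine ⟨?_, ?_, ?_⟩
  · have := (h1Surjective_comap hπ hπ' hA hA' hσ).2
      (h1Surjective_of_central hR hR' hst hst' hσe hσR hs h2 hS)
    rwa [eT, eT', eK, eK'] at this
  · have := (h1Injective_comap hπ hπ' hA hA' hσ).2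
      (h1Injective_of_central hR hR' hst hst' hσe hσR hi hT hI)
    rwa [eT, eT', eK, eK'] at this
  · have := (twistedH0Surjective_comap hπ hπ' hA hA' hσ).2
      (twistedH0Surjective_of_central hR hR' hst hst' hσe hσR hi h0 hT)
    rwa [eK, eK'] at this

end Step

end GAction

/-- Corollary for filtered `G`-groups, functorial version.
Let `Q`, `Q'` be `G`-groups with central filtrations
`Q = N 1 ≥ ⋯ ≥ N (n+1) = 1` and `Q' = N' 1 ≥ ⋯ ≥ N' (n+1) = 1` of the same length
by `G`-stable normal subgroups, and let `ρ : Q → Q'` be a `G`-equivariant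
homomorphism with `ρ (N i) ≤ N' i`.  Cohomology with coefficients in the abelian
`G`-group `N j / N (j+1)` is encoded via representatives in `N j`, congruence
being modulo `N (j+1)`.  If for every `1 ≤ j ≤ n` the map induced by `ρ` on
`H¹(G, N j/N (j+1)) → H¹(G, N' j/N' (j+1))` is bijective, on `H⁰` is surjective
and on `H²` is injective, then the induced map `H¹(G,Q) → H¹(G,Q')` is a
bijection. -/
theorem filtered_h1_functorial_bijective
    {G Q Q' : Type*} [Group G] [Group Q] [Group Q']
    (A : GAction G Q) (A' : GAction G Q') (n : ℕ)
    (N : ℕ → Subgroup Q) (N' : ℕ → Subgroup Q')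
    (hN1 : N 1 = ⊤) (hNlast : N (n + 1) = ⊥)
    (hN'1 : N' 1 = ⊤) (hN'last : N' (n + 1) = ⊥)
    (hmono : ∀ i : ℕ, N (i + 1) ≤ N i) (hmono' : ∀ i : ℕ, N' (i + 1) ≤ N' i)
    (hnormal : ∀ i : ℕ, (N i).Normal) (hnormal' : ∀ i : ℕ, (N' i).Normal)
    (hstable : ∀ i : ℕ, ∀ q ∈ N i, ∀ g : G, A.act q g ∈ N i)
    (hstable' : ∀ i : ℕ, ∀ q ∈ N' i, ∀ g : G, A'.act q g ∈ N' i)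
    (hcentral : ∀ i : ℕ, ∀ q ∈ N i, ∀ q' : Q, q * q' * q⁻¹ * q'⁻¹ ∈ N (i + 1))
    (hcentral' : ∀ i : ℕ, ∀ q ∈ N' i, ∀ q' : Q', q * q' * q⁻¹ * q'⁻¹ ∈ N' (i + 1))
    (ρ : Q →* Q')
    (hρequiv : ∀ (q : Q) (g : G), ρ (A.act q g) = A'.act (ρ q) g)
    (hρfilt : ∀ i : ℕ, ∀ q ∈ N i, ρ q ∈ N' i)
    -- `H¹(G, N j/N (j+1)) → H¹(G, N' j/N' (j+1))` is surjective for `1 ≤ j ≤ n`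
    (h1s : ∀ j : ℕ, 1 ≤ j → j ≤ n →
      ∀ β : G → Q', (∀ g : G, β g ∈ N' j) →
      (∀ g h : G, (β (g * h))⁻¹ * (A'.act (β g) h * β h) ∈ N' (j + 1)) →
      ∃ γ : G → Q, (∀ g : G, γ g ∈ N j) ∧
        (∀ g h : G, (γ (g * h))⁻¹ * (A.act (γ g) h * γ h) ∈ N (j + 1)) ∧
        ∃ q ∈ N' j, ∀ g : G, (β g)⁻¹ * ((A'.act q g)⁻¹ * ρ (γ g) * q) ∈ N' (j + 1))
    -- `H¹(G, N j/N (j+1)) → H¹(G, N' j/N' (j+1))` is injective for `1 ≤ j ≤ n`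
    (h1i : ∀ j : ℕ, 1 ≤ j → j ≤ n →
      ∀ γ δ : G → Q, (∀ g : G, γ g ∈ N j) → (∀ g : G, δ g ∈ N j) →
      (∀ g h : G, (γ (g * h))⁻¹ * (A.act (γ g) h * γ h) ∈ N (j + 1)) →
      (∀ g h : G, (δ (g * h))⁻¹ * (A.act (δ g) h * δ h) ∈ N (j + 1)) →
      (∃ q ∈ N' j, ∀ g : G, (ρ (δ g))⁻¹ * ((A'.act q g)⁻¹ * ρ (γ g) * q) ∈ N' (j + 1)) →
      ∃ q ∈ N j, ∀ g : G, (δ g)⁻¹ * ((A.act q g)⁻¹ * γ g * q) ∈ N (j + 1))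
    -- `H⁰(G, N j/N (j+1)) → H⁰(G, N' j/N' (j+1))` is surjective for `1 ≤ j ≤ n`
    (h0 : ∀ j : ℕ, 1 ≤ j → j ≤ n →
      ∀ q' ∈ N' j, (∀ g : G, (A'.act q' g)⁻¹ * q' ∈ N' (j + 1)) →
      ∃ q ∈ N j, (∀ g : G, (A.act q g)⁻¹ * q ∈ N (j + 1)) ∧ (ρ q)⁻¹ * q' ∈ N' (j + 1))
    -- `H²(G, N j/N (j+1)) → H²(G, N' j/N' (j+1))` is injective for `1 ≤ j ≤ n`
    (h2 : ∀ j : ℕ, 1 ≤ j → j ≤ n →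
      ∀ τ τ' : G → G → Q, (∀ g h : G, τ g h ∈ N j) → (∀ g h : G, τ' g h ∈ N j) →
      (∀ g h k : G, (A.act (τ g h) k * τ (g * h) k)⁻¹ * (τ h k * τ g (h * k)) ∈ N (j + 1)) →
      (∀ g h k : G, (A.act (τ' g h) k * τ' (g * h) k)⁻¹ * (τ' h k * τ' g (h * k)) ∈ N (j + 1)) →
      (∃ φ : G → Q', (∀ g : G, φ g ∈ N' j) ∧ ∀ g h : G,
        (ρ (τ' g h))⁻¹ * (ρ (τ g h) * A'.act (φ g) h * φ h * (φ (g * h))⁻¹) ∈ N' (j + 1)) →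
      ∃ φ : G → Q, (∀ g : G, φ g ∈ N j) ∧ ∀ g h : G,
        (τ' g h)⁻¹ * (τ g h * A.act (φ g) h * φ h * (φ (g * h))⁻¹) ∈ N (j + 1)) :
    -- the induced map `H¹(G,Q) → H¹(G,Q')` is a bijection
    (∀ β : G → Q', A'.IsCocycle β →
      ∃ γ : G → Q, A.IsCocycle γ ∧ A'.Cohomologous (fun g => ρ (γ g)) β)
    ∧ (∀ γ δ : G → Q, A.IsCocycle γ → A.IsCocycle δ →
      A'.Cohomologous (fun g => ρ (γ g)) (fun g => ρ (δ g)) → A.Cohomologous γ δ) := by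
  have key : ∀ k ≤ n, A.H1Surjective A' ρ ⊤ (N (k + 1)) ⊤ (N' (k + 1)) ∧
      A.H1Injective A' ρ ⊤ (N (k + 1)) ⊤ (N' (k + 1)) ∧
      A.TwistedH0Surjective A' ρ (N (k + 1)) (N' (k + 1)) := by
    intro k
    induction k with
    | zero =>
      intro _
      rw [hN1, hN'1]
      exact ⟨fun _ _ _ => ⟨1, by simp, by simp, 1, by simp⟩,
        fun _ _ _ _ _ _ _ => ⟨1, by simp⟩, fun _ _ _ _ => ⟨1, by simp⟩⟩
    | succ k ih =>
      intro hk
      obtain ⟨hS, hI, hT⟩ := ih (by omega)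
      have := hnormal (k + 1 + 1)
      have := hnormal' (k + 1 + 1)
      exact GAction.central_step (hmono _) (hmono' _) (hstable _) (hstable _) (hstable' _)
        (hstable' _) (hcentral _) (hcentral' _) hρequiv (hρfilt _) (hρfilt _)
        (h1s _ (by omega) hk) (h1i _ (by omega) hk) (h0 _ (by omega) hk) (h2 _ (by omega) hk)
        hS hI hT
  obtain ⟨hS, hI, -⟩ := key n le_rfl
  rw [hNlast, hN'last] at hS hI
  simp only [GAction.H1Surjective, GAction.H1Injective, Subgroup.mem_top, Subgroup.mem_bot,
    inv_mul_eq_one, forall_const, true_and] at hS hI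
  exact ⟨hS, hI⟩
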